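/- Fix reals a, and α, σ, ᾱ, σ̄ > 0, and α' ≠ 0. Set D := ᾱ² σ² + α² σ̄² and σ'² := α'² σ² σ̄² / D (so σ² − (α/α')² σ'² = σ² ᾱ² σ² / D ≥ 0). Let γ denote the standard Gaussian measure N(0,1) on ℝ and γ ⊗ γ the product measure on ℝ². Define f : ℝ² → ℝ² by f(ε₁, ε₂) := ( α a + σ ε₂ , α' (ᾱ σ² (ᾱ a + σ̄ ε₁) + α σ̄² (α a + σ ε₂)) / D ), and define h : ℝ² → ℝ² by h(η₁, η₂) := ( (α/α')(α' a + σ' η₁) + √(σ² − (α/α')² σ'²) η₂ , α' a + σ' η₁ ), where σ' := √(σ'²). Then the pushforward measures (γ ⊗ γ).map f and (γ ⊗ γ).map h on ℝ² are equal. -/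

import Mathlib

open MeasureTheory ProbabilityTheory

/-- The integral of a character of `ℝ × ℝ` against an affine image of the standard Gaussian. -/
lemma integral_cexp_affine_stdGaussian_prod (c p q : ℝ) :
    ∫ x : ℝ × ℝ, Complex.exp (((c + (p * x.1 + q * x.2) : ℝ) : ℂ) * Complex.I)
      ∂((gaussianReal 0 1).prod (gaussianReal 0 1))
      = Complex.exp (c * Complex.I - ((p ^ 2 + q ^ 2 : ℝ) : ℂ) / 2) := by
  have hsplit (x : ℝ × ℝ) :
      Complex.exp (((c + (p * x.1 + q * x.2) : ℝ) : ℂ) * Complex.I)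
        = Complex.exp (c * Complex.I) *
          (Complex.exp (p * x.1 * Complex.I) * Complex.exp (q * x.2 * Complex.I)) := by
    rw [← Complex.exp_add, ← Complex.exp_add]
    push_cast
    ring_nf
  simp_rw [hsplit]
  rw [integral_const_mul,
    integral_prod_mul (fun x : ℝ => Complex.exp (p * x * Complex.I))
      (fun x : ℝ => Complex.exp (q * x * Complex.I)),
    ← charFun_apply_real, ← charFun_apply_real, charFun_gaussianReal, charFun_gaussianReal,
    ← Complex.exp_add, ← Complex.exp_add]
  push_cast
  ring_nf

/-- Two affine images of the standard Gaussian on `ℝ × ℝ` with the same mean agree as soon as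
their covariances do. -/
lemma map_affine_stdGaussian_prod_eq {m n p q r s p' q' r' s' : ℝ}
    (h₁ : p ^ 2 + q ^ 2 = p' ^ 2 + q' ^ 2) (h₂ : r ^ 2 + s ^ 2 = r' ^ 2 + s' ^ 2)
    (h₁₂ : p * r + q * s = p' * r' + q' * s') :
    ((gaussianReal 0 1).prod (gaussianReal 0 1)).map
        (fun x : ℝ × ℝ => (m + (p * x.1 + q * x.2), n + (r * x.1 + s * x.2)))
      = ((gaussianReal 0 1).prod (gaussianReal 0 1)).map
        (fun x : ℝ × ℝ => (m + (p' * x.1 + q' * x.2), n + (r' * x.1 + s' * x.2))) := by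
  have hmeas (p q r s : ℝ) : Measurable
      (fun x : ℝ × ℝ => (m + (p * x.1 + q * x.2), n + (r * x.1 + s * x.2))) := by fun_prop
  have := Measure.isProbabilityMeasure_map (μ := (gaussianReal 0 1).prod (gaussianReal 0 1))
    (hmeas p q r s).aemeasurable
  have := Measure.isProbabilityMeasure_map (μ := (gaussianReal 0 1).prod (gaussianReal 0 1))
    (hmeas p' q' r' s').aemeasurable
  refine Measure.ext_of_charFunDual (funext fun L => ?_)
  have hL (x y : ℝ) : L (x, y) = x * L (1, 0) + y * L (0, 1) := by
    rw [← smul_eq_mul, ← smul_eq_mul, ← map_smul, ← map_smul, ← map_add]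
    simp
  have hchar (p q r s : ℝ) : charFunDual (((gaussianReal 0 1).prod (gaussianReal 0 1)).map
        (fun x : ℝ × ℝ => (m + (p * x.1 + q * x.2), n + (r * x.1 + s * x.2)))) L
      = Complex.exp ((m * L (1, 0) + n * L (0, 1) : ℝ) * Complex.I -
        (((p * L (1, 0) + r * L (0, 1)) ^ 2 + (q * L (1, 0) + s * L (0, 1)) ^ 2 : ℝ) : ℂ) / 2) := by
    rw [charFunDual_apply, integral_map (hmeas p q r s).aemeasurable (by fun_prop),
      ← integral_cexp_affine_stdGaussian_prod]
    congr with x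
    rw [hL]
    ring_nf
  rw [hchar, hchar]
  congr 4
  linear_combination L (1, 0) ^ 2 * h₁ + L (0, 1) ^ 2 * h₂ + 2 * L (1, 0) * L (0, 1) * h₁₂

/-- Proposition 2 (Diamond DDPM sampling), stated per coordinate: the joint law of
`(X_t, X_{t'})` produced by Diamond Early Stop DDPM sampling from independent Gaussian
noisings of `a` equals the joint law produced by the DDPM (forward-kernel) construction,
as an equality of pushforwards of the two-dimensional standard Gaussian. -/
theorem stmt11 (a α σ αbar σbar α' : ℝ)
    (hα : 0 < α) (hσ : 0 < σ) (hαbar : 0 < αbar) (hσbar : 0 < σbar) (hα' : α' ≠ 0)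
    (D σ'sq σ' : ℝ)
    (hD : D = αbar ^ 2 * σ ^ 2 + α ^ 2 * σbar ^ 2)
    (hσ'sq : σ'sq = α' ^ 2 * σ ^ 2 * σbar ^ 2 / D)
    (hσ' : σ' = Real.sqrt σ'sq)
    (f h : ℝ × ℝ → ℝ × ℝ)
    (hf : ∀ ε : ℝ × ℝ, f ε = (α * a + σ * ε.2,
      α' * (αbar * σ ^ 2 * (αbar * a + σbar * ε.1) + α * σbar ^ 2 * (α * a + σ * ε.2)) / D))
    (hh : ∀ η : ℝ × ℝ, h η = ((α / α') * (α' * a + σ' * η.1)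
        + Real.sqrt (σ ^ 2 - (α / α') ^ 2 * σ'sq) * η.2,
      α' * a + σ' * η.1)) :
    Measure.map f ((gaussianReal 0 1).prod (gaussianReal 0 1))
      = Measure.map h ((gaussianReal 0 1).prod (gaussianReal 0 1)) := by
  have hDpos : 0 < D := by rw [hD]; positivity
  have hσ'_sq : σ' ^ 2 = α' ^ 2 * σ ^ 2 * σbar ^ 2 / D := by
    rw [hσ', Real.sq_sqrt (by rw [hσ'sq]; positivity), hσ'sq]
  have hvar : σ ^ 2 - (α / α') ^ 2 * σ'sq = σ ^ 2 * αbar ^ 2 * σ ^ 2 / D := by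
    rw [hσ'sq]
    field_simp
    rw [hD]
    ring
  have hsqrt : Real.sqrt (σ ^ 2 - (α / α') ^ 2 * σ'sq) ^ 2 = σ ^ 2 * αbar ^ 2 * σ ^ 2 / D := by
    rw [Real.sq_sqrt (by rw [hvar]; positivity), hvar]
  have hf_affine : f = fun x => (α * a + (0 * x.1 + σ * x.2), α' * a +
      (α' * αbar * σ ^ 2 * σbar / D * x.1 + α' * α * σbar ^ 2 * σ / D * x.2)) := by
    funext x
    rw [hf]
    congr 1
    · ring
    · field_simp
      rw [hD]
      ring
  have hh_affine : h = fun x => (α * a + (α / α' * σ' * x.1 +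
      Real.sqrt (σ ^ 2 - (α / α') ^ 2 * σ'sq) * x.2), α' * a + (σ' * x.1 + 0 * x.2)) := by
    funext x
    rw [hh]
    congr 1
    · field_simp
      ring
    · ring
  rw [hf_affine, hh_affine]
  apply map_affine_stdGaussian_prod_eq
  · rw [hsqrt, mul_pow, hσ'_sq]
    field_simp
    rw [hD]
    ring
  · rw [hσ'_sq]
    field_simp
    rw [hD]
    ring
  · rw [mul_zero, add_zero, mul_assoc (α / α'), ← sq, hσ'_sq]
    field_simp
    ring
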